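/- arXiv:1809.08867 — 2 statements merged into one kernel-verified Lean document; each statement's English description precedes it below -/
import Mathlib

section
/- Let n ≥ 1 and let 𝛂 = (α_1,…,α_n), 𝛃 = (β_1,…,β_n) ∈ [0,1)^n be tuples of real numbers such that α_i ≠ β_j for all i, j ∈ {1,…,n}. Then for every m ∈ {1,…,n}, one has p(𝛂,𝛃,α_m) − (#{j ∈ {1,…,n} : β_j < α_m} − #{i ∈ {1,…,n} : α_i < α_m}) = #{k ∈ {1,…,n} : α_k < β_k}. -/
attribute [local instance] Classical.propDecidable

/-- `CircSep a g b` means the pair `(a, b)` is separated by `g` on the oriented circle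
parametrized by `[0,1)`: either `0 ≤ a < g < b < 1`, or `0 ≤ g < b < a < 1`,
or `0 ≤ b < a < g < 1`. (For points already in `[0,1)`, the inequalities `0 ≤ ·`
and `· < 1` are automatic.) -/
def CircSep (a g b : ℝ) : Prop :=
  (a < g ∧ g < b) ∨ (g < b ∧ b < a) ∨ (b < a ∧ a < g)

/-- `pCount α β γ = #{k | ¬ (α k → γ → β k)}`. -/
noncomputable def pCount {n : ℕ} (α β : Fin n → ℝ) (γ : ℝ) : ℕ :=
  (Finset.univ.filter (fun k : Fin n => ¬ CircSep (α k) γ (β k))).card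

/-- Pointwise form of the count identity, in terms of indicators. -/
theorem indicator_not_circSep_sub {a b g : ℝ} (hab : a ≠ b) (hgb : g ≠ b) :
    (if ¬ CircSep a g b then (1 : ℤ) else 0) -
      ((if b < g then 1 else 0) - (if a < g then 1 else 0)) = if a < b then 1 else 0 := by
  unfold CircSep
  grind

theorem stmt_0 {n : ℕ} (hn : 1 ≤ n) (α β : Fin n → ℝ)
    (hα : ∀ i, α i ∈ Set.Ico (0 : ℝ) 1) (hβ : ∀ j, β j ∈ Set.Ico (0 : ℝ) 1)
    (hne : ∀ i j, α i ≠ β j) (m : Fin n) :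
    (pCount α β (α m) : ℤ) -
      (((Finset.univ.filter (fun j : Fin n => β j < α m)).card : ℤ) -
        ((Finset.univ.filter (fun i : Fin n => α i < α m)).card : ℤ)) =
      ((Finset.univ.filter (fun k : Fin n => α k < β k)).card : ℤ) := by
  simp only [pCount, Finset.card_filter, Nat.cast_sum, Nat.cast_ite, Nat.cast_one,
    Nat.cast_zero, ← Finset.sum_sub_distrib]
  exact Finset.sum_congr rfl fun k _ => indicator_not_circSep_sub (hne k k) (hne m k)
end

section
/- Let n ≥ 1 and let 𝛂 = (α_1,…,α_n), 𝛃 = (β_1,…,β_n) ∈ [0,1)^n be tuples of real numbers such that α_i ≠ β_j for all i, j ∈ {1,…,n}. Then for every m ∈ {1,…,n}, one has p(𝛂,𝛃,β_m) − (#{j ∈ {1,…,n} : β_j ≤ β_m} − #{i ∈ {1,…,n} : α_i < β_m}) = #{k ∈ {1,…,n} : α_k < β_k}. -/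
attribute [local instance] Classical.propDecidable

/-- The contribution of a single pair `(a, b)` to the counting identity for `pCount`. -/
theorem indicator_not_circSep {a b g : ℝ} (hab : a ≠ b) :
    (if ¬ CircSep a g b then (1 : ℤ) else 0) -
      ((if b ≤ g then 1 else 0) - (if a < g then 1 else 0)) = if a < b then 1 else 0 := by
  unfold CircSep
  grind

theorem stmt_1 {n : ℕ} (hn : 1 ≤ n) (α β : Fin n → ℝ)
    (hα : ∀ i, α i ∈ Set.Ico (0 : ℝ) 1) (hβ : ∀ j, β j ∈ Set.Ico (0 : ℝ) 1)
    (hne : ∀ i j, α i ≠ β j) (m : Fin n) :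
    (pCount α β (β m) : ℤ) -
      (((Finset.univ.filter (fun j : Fin n => β j ≤ β m)).card : ℤ) -
        ((Finset.univ.filter (fun i : Fin n => α i < β m)).card : ℤ)) =
      ((Finset.univ.filter (fun k : Fin n => α k < β k)).card : ℤ) := by
  simp only [pCount, Finset.card_filter, Nat.cast_sum, Nat.cast_ite, Nat.cast_one, Nat.cast_zero,
    ← Finset.sum_sub_distrib]
  exact Finset.sum_congr rfl fun k _ => indicator_not_circSep (hne k k)
end
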